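/- A variety X is semiprojective (i.e., projective over an affine variety) if and only if X is quasiprojective and semicomplete (i.e., the affine contraction morphism X → Spec H⁰(X, O_X) is proper; equivalently X is proper over some affine variety). -/

import Mathlib

open AlgebraicGeometry CategoryTheory

attribute [local instance] MvPolynomial.gradedAlgebra

/-- Projective `n`-space over a commutative ring `R`, as `Proj` of the standard graded
polynomial ring. -/
noncomputable def ProjectiveSpaceOver (R : Type) [CommRing R] (n : ℕ) :
    AlgebraicGeometry.Scheme :=
  AlgebraicGeometry.Proj (MvPolynomial.homogeneousSubmodule (Fin n) R)

/-- `X` is semiprojective over `k`: `X` is projective over an affine variety, i.e. admits a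
closed embedding into some projective space over a finitely generated `k`-algebra domain. -/
def IsSemiprojective (k : Type) [Field k] (X : AlgebraicGeometry.Scheme) : Prop :=
  ∃ (R : Type) (_ : CommRing R) (_ : IsDomain R) (_ : Algebra k R)
    (_ : Algebra.FiniteType k R) (n : ℕ) (i : X ⟶ ProjectiveSpaceOver R n),
    AlgebraicGeometry.IsClosedImmersion i

/-- `X` is quasiprojective over `k`: it admits an immersion into some projective space over
`k`. -/
def IsQuasiprojective (k : Type) [Field k] (X : AlgebraicGeometry.Scheme) : Prop :=
  ∃ (n : ℕ) (i : X ⟶ ProjectiveSpaceOver k n), AlgebraicGeometry.IsImmersion i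

/-- `X` is semicomplete: it is proper over some affine scheme (equivalently, the affine
contraction morphism `X → Spec H⁰(X, O_X)` is proper). -/
def IsSemicomplete (X : AlgebraicGeometry.Scheme) : Prop :=
  ∃ (Z : AlgebraicGeometry.Scheme) (p : X ⟶ Z),
    AlgebraicGeometry.IsAffine Z ∧ AlgebraicGeometry.IsProper p

namespace SemiProj

open MvPolynomial HomogeneousLocalization

section algebra

variable {k R : Type} [CommRing k] [CommRing R] {τ σ : Type}

/-- Graded hom given by a coefficient map and linear forms. -/
noncomputable def gEval (φ : k →+* R) (v : τ → MvPolynomial σ R)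
    (hv : ∀ i, (v i).IsHomogeneous 1) :
    homogeneousSubmodule τ k →+*ᵍ homogeneousSubmodule σ R where
  toRingHom := eval₂Hom (C.comp φ) v
  map_mem {i x} hx := by
    have := MvPolynomial.IsHomogeneous.eval₂ (n := 1) (m := i) (hφ := hx) (C.comp φ) v
      (fun j => isHomogeneous_C _ _) hv
    simpa using this

@[simp] lemma gEval_X (φ : k →+* R) (v : τ → MvPolynomial σ R) (hv) (i : τ) :
    gEval φ v hv (X i) = v i := by
  change eval₂Hom (C.comp φ) v (X i) = _
  simp

@[simp] lemma gEval_C (φ : k →+* R) (v : τ → MvPolynomial σ R) (hv) (a : k) :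
    gEval φ v hv (C a) = C (φ a) := by
  change eval₂Hom (C.comp φ) v (C a) = _
  simp

lemma irrelevant_le_span :
    (HomogeneousIdeal.irrelevant (homogeneousSubmodule σ R)).toIdeal ≤
      Ideal.span (Set.range (X : σ → MvPolynomial σ R)) := by
  rw [HomogeneousIdeal.toIdeal_irrelevant_le]
  intro i hi x hx
  have hx' : x.IsHomogeneous i := hx
  change x ∈ Ideal.span (Set.range X)
  rw [← Set.image_univ, mem_ideal_span_X_image]
  intro m hm
  have := hx' (mem_support_iff.mp hm)
  by_contra! h
  have : m = 0 := by ext j; simpa using h j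
  subst this
  simp at *
  omega

lemma gEval_irrelevant (φ : k →+* R) (v : τ → MvPolynomial σ R) (hv)
    (hX : ∀ j, ∃ i, v i = X j) :
    HomogeneousIdeal.irrelevant (homogeneousSubmodule σ R) ≤
      (HomogeneousIdeal.irrelevant (homogeneousSubmodule τ k)).map (gEval φ v hv) := by
  change (HomogeneousIdeal.irrelevant (homogeneousSubmodule σ R)).toIdeal ≤
    ((HomogeneousIdeal.irrelevant (homogeneousSubmodule τ k)).map (gEval φ v hv)).toIdeal
  refine irrelevant_le_span.trans ?_
  rw [Ideal.span_le]
  rintro _ ⟨j, rfl⟩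
  obtain ⟨i, hi⟩ := hX j
  rw [← hi, ← gEval_X φ v hv]
  refine Ideal.mem_map_of_mem _ ?_
  exact HomogeneousIdeal.mem_irrelevant_of_mem _ (i := 1) one_pos (isHomogeneous_X _ _)

lemma X_mem (l : σ) : (X l : MvPolynomial σ R) ∈ homogeneousSubmodule σ R 1 :=
  isHomogeneous_X _ _

/-- The charts. -/
abbrev Chart (R : Type) [CommRing R] (l : σ) : Type :=
  Away (homogeneousSubmodule σ R) (X l : MvPolynomial σ R)

/-- constants in degree zero -/
noncomputable def cZero (σ R : Type) [CommRing R] : R →+* homogeneousSubmodule σ R 0 where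
  toFun a := ⟨C a, isHomogeneous_C _ _⟩
  map_one' := by ext1; simp
  map_mul' a b := by ext1; simp
  map_zero' := by ext1; simp
  map_add' a b := by ext1; simp

noncomputable def cChart (l : σ) : R →+* Chart R l :=
  (fromZeroRingHom _ _).comp (cZero σ R)

/-- the coordinate X m / X l -/
noncomputable def xChart (l m : σ) : Chart R l :=
  Away.mk _ (X_mem l) 1 (X m) (by simpa using X_mem m)

noncomputable def deh (l : σ) : MvPolynomial σ R →+* Chart R l :=
  eval₂Hom (cChart l) (xChart l)

lemma deh_C (l : σ) (a : R) : deh l (C a) = cChart l a := by simp [deh]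
lemma deh_X (l m : σ) : deh l (X m : MvPolynomial σ R) = xChart l m := by simp [deh]

lemma val_cChart (l : σ) (a : R) : (cChart l a).val =
    algebraMap (MvPolynomial σ R) (Localization.Away (X l : MvPolynomial σ R)) (C a) := by
  rfl

lemma val_xChart (l m : σ) : (xChart (R := R) l m).val *
      algebraMap (MvPolynomial σ R) (Localization.Away (X l : MvPolynomial σ R)) (X l) =
    algebraMap (MvPolynomial σ R) (Localization.Away (X l : MvPolynomial σ R)) (X m) := by
  rw [xChart, Away.val_mk, Localization.mk_eq_mk']
  simp

lemma xChart_self (l : σ) : xChart (R := R) l l = 1 := by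
  ext
  rw [xChart, Away.val_mk, val_one, Localization.mk_eq_mk']
  simp

lemma val_deh (l : σ) (p : MvPolynomial σ R) (d : ℕ) (hp : p.IsHomogeneous d) :
    (deh l p).val *
      algebraMap (MvPolynomial σ R) (Localization.Away (X l : MvPolynomial σ R)) (X l) ^ d =
    algebraMap (MvPolynomial σ R) (Localization.Away (X l : MvPolynomial σ R)) p := by
  have key : ∀ (S : Type) [CommRing S] (f : R →+* S) (v : σ → S) (c : S),
      eval₂ f v p * c ^ d = eval₂ f (fun i => v i * c) p := by
    intro S _ f v c
    rw [eval₂_eq, eval₂_eq, Finset.sum_mul]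
    refine Finset.sum_congr rfl fun m hm => ?_
    have := hp (mem_support_iff.mp hm)
    rw [mul_assoc]
    congr 1
    simp_rw [mul_pow]
    rw [Finset.prod_mul_distrib, Finset.prod_pow_eq_pow_sum]
    congr 2
    rw [← this, Finsupp.weight_apply, Finsupp.sum]
    simp
  have h1 : (deh l p).val = 
      eval₂ ((algebraMap (MvPolynomial σ R) (Localization.Away (X l : MvPolynomial σ R))).comp C)
      (fun m => (xChart l m).val) p := by
    rw [← HomogeneousLocalization.algebraMap_apply, deh, coe_eval₂Hom, eval₂_comp_left]
    rfl
  rw [h1, key]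
  simp_rw [val_xChart]
  rw [← Function.comp_def, ← eval₂_comp_left, eval₂_eta]

lemma deh_surjective (l : σ) : Function.Surjective (deh (R := R) l) := by
  intro x
  obtain ⟨n, a, ha, rfl⟩ := Away.mk_surjective _ (X_mem l) x
  refine ⟨a, ?_⟩
  ext
  rw [Away.val_mk, Localization.mk_eq_mk', IsLocalization.eq_mk'_iff_mul_eq]
  simpa using val_deh l a n (by simpa using ha)

/-- induced map on charts -/
noncomputable def gMap (φ : k →+* R) (v : τ → MvPolynomial σ R) (hv : ∀ i, (v i).IsHomogeneous 1)
    (i : τ) (l : σ)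
    (h : v i = X l) : Chart k i →+* Chart R l :=
  HomogeneousLocalization.map (gEval φ v hv) (by
    rintro _ ⟨n, rfl⟩; exact ⟨n, by simp [h]⟩)

lemma gMap_c (φ : k →+* R) (v : τ → MvPolynomial σ R) (hv : ∀ i, (v i).IsHomogeneous 1)
    (i : τ) (l : σ)
    (h : v i = X l) (a : k) : gMap φ v hv i l h (cChart i a) = cChart l (φ a) := by
  ext
  rw [val_cChart]
  change (HomogeneousLocalization.map _ _ (HomogeneousLocalization.mk _)).val = _
  rw [map_mk, val_mk, Localization.mk_eq_mk']
  simp [cZero]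
  exact IsLocalization.mk'_one _ _

lemma gMap_x (φ : k →+* R) (v : τ → MvPolynomial σ R) (hv : ∀ i, (v i).IsHomogeneous 1)
    (i : τ) (l : σ)
    (h : v i = X l) (j : τ) : gMap φ v hv i l h (xChart i j) = deh l (v j) := by
  ext
  change (HomogeneousLocalization.map _ _ (HomogeneousLocalization.mk _)).val = _
  rw [map_mk, val_mk, Localization.mk_eq_mk', eq_comm, IsLocalization.eq_mk'_iff_mul_eq]
  simpa [h] using val_deh l (v j) 1 (hv j)

/-- the lift from a chart -/
noncomputable def chartLift {T : Type} [CommRing T] (l : σ) (g : R →+* T) (v : σ → T)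
    (hl : v l = 1) : Chart R l →+* T :=
  (IsLocalization.Away.lift (S := Localization.Away (X l : MvPolynomial σ R)) (X l)
    (g := eval₂Hom g v) (by simp [hl])).comp (algebraMap (Chart R l) _)

lemma chartLift_c {T : Type} [CommRing T] (l : σ) (g : R →+* T) (v : σ → T)
    (hl : v l = 1) (a : R) : chartLift l g v hl (cChart l a) = g a := by
  simp only [chartLift, RingHom.comp_apply, HomogeneousLocalization.algebraMap_apply, val_cChart]
  simp

lemma chartLift_x {T : Type} [CommRing T] (l : σ) (g : R →+* T) (v : σ → T)
    (hl : v l = 1) (m : σ) : chartLift l g v hl (xChart l m) = v m := by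
  simp only [chartLift, RingHom.comp_apply, HomogeneousLocalization.algebraMap_apply]
  have := congr(IsLocalization.Away.lift (S := Localization.Away (X l : MvPolynomial σ R)) (X l)
    (g := eval₂Hom g v) (by simp [hl]) $(val_xChart (R := R) l m))
  simpa [hl] using this

lemma chart_hom_ext {T : Type} [CommRing T] (l : σ) {f g : Chart R l →+* T}
    (h1 : ∀ a, f (cChart l a) = g (cChart l a)) (h2 : ∀ m, f (xChart l m) = g (xChart l m)) :
    f = g := by
  rw [← RingHom.cancel_right (deh_surjective l)]
  apply MvPolynomial.ringHom_ext
  · intro a; simpa [deh_C] using h1 a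
  · intro a; simpa [deh_X] using h2 a

lemma chart_isPushout (φ : k →+* R) (l : σ) :
    IsPushout (CommRingCat.ofHom φ) (CommRingCat.ofHom (cChart (R := k) l))
      (CommRingCat.ofHom (cChart (R := R) l))
      (CommRingCat.ofHom (gMap φ X (fun i => isHomogeneous_X R i) l l rfl)) := by
  have w : CommRingCat.ofHom φ ≫ CommRingCat.ofHom (cChart (R := R) l) =
      CommRingCat.ofHom (cChart (R := k) l) ≫
      CommRingCat.ofHom (gMap φ X (fun i => isHomogeneous_X R i) l l rfl) := by
    ext1
    exact RingHom.ext fun a => (gMap_c φ _ _ _ _ rfl a).symm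
  refine ⟨⟨w⟩, ⟨Limits.PushoutCocone.IsColimit.mk w
    (fun s => CommRingCat.ofHom (chartLift l s.inl.hom (fun m => s.inr.hom (xChart l m))
      (by rw [xChart_self, map_one]))) ?_ ?_ ?_⟩⟩
  · intro s
    ext a
    exact chartLift_c l s.inl.hom (fun m => s.inr.hom (xChart l m)) (by rw [xChart_self, map_one]) a
  · intro s
    ext1
    apply chart_hom_ext
    · intro a
      have := congr($(s.condition).hom a)
      simpa [gMap_c, chartLift_c] using this
    · intro m
      simp [gMap_x, deh_X, chartLift_x]
  · intro s m h1 h2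
    ext1
    apply chart_hom_ext
    · intro a
      have := congr(($h1).hom a)
      simpa [chartLift_c] using this
    · intro j
      have := congr(($h2).hom (xChart l j))
      simpa [gMap_x, deh_X, chartLift_x] using this

end algebra

section geometry

variable {k R : Type} [CommRing k] [CommRing R] {τ σ : Type}

noncomputable abbrev PP (σ R : Type) [CommRing R] : Scheme := Proj (homogeneousSubmodule σ R)

noncomputable def strMap (σ R : Type) [CommRing R] : PP σ R ⟶ Spec (CommRingCat.of R) :=
  Proj.toSpecZero (homogeneousSubmodule σ R) ≫ Spec.map (CommRingCat.ofHom (cZero σ R))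

instance : IsSeparated (strMap σ R) := by
  unfold strMap; infer_instance

noncomputable def chartι (R : Type) [CommRing R] (l : σ) :
    Spec (CommRingCat.of (Chart R l)) ⟶ PP σ R :=
  Proj.awayι _ (X l) (X_mem l) one_pos

instance (l : σ) : IsOpenImmersion (chartι R l) := by unfold chartι; infer_instance

lemma chartι_strMap (l : σ) : chartι R l ≫ strMap σ R = Spec.map (CommRingCat.ofHom (cChart l)) := by
  rw [chartι, strMap, Proj.awayι_toSpecZero_assoc, ← Spec.map_comp]
  rfl

noncomputable def chartCover (σ R : Type) [CommRing R] : (PP σ R).AffineOpenCover :=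
  Proj.affineOpenCoverOfIrrelevantLESpan _ (m := fun _ => 1) (X : σ → MvPolynomial σ R)
    (fun l => X_mem l) (fun _ => one_pos) irrelevant_le_span

/-- the basic opens -/
noncomputable abbrev DD (R : Type) [CommRing R] (l : σ) : (PP σ R).Opens :=
  Proj.basicOpen (homogeneousSubmodule σ R) (X l)

lemma iSup_DD : ⨆ l : σ, DD R l = ⊤ :=
  Proj.iSup_basicOpen_eq_top _ _ irrelevant_le_span

lemma opensRange_chartι (l : σ) : (chartι R l).opensRange = DD R l :=
  Proj.opensRange_awayι _ _ _ _

noncomputable def pMap (φ : k →+* R) (v : τ → MvPolynomial σ R)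
    (hv : ∀ i, (v i).IsHomogeneous 1) (hX : ∀ j, ∃ i, v i = X j) : PP σ R ⟶ PP τ k :=
  Proj.map (gEval φ v hv) (gEval_irrelevant φ v hv hX)

lemma pMap_preimage (φ : k →+* R) (v : τ → MvPolynomial σ R)
    (hv : ∀ i, (v i).IsHomogeneous 1) (hX : ∀ j, ∃ i, v i = X j) (i : τ) (l : σ) (h : v i = X l) :
    pMap φ v hv hX ⁻¹ᵁ DD k i = DD R l := by
  rw [pMap, Proj.map_preimage_basicOpen, gEval_X, h]

lemma chartι_pMap (φ : k →+* R) (v : τ → MvPolynomial σ R)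
    (hv : ∀ i, (v i).IsHomogeneous 1) (hX : ∀ j, ∃ i, v i = X j) (i : τ) (l : σ) (h : v i = X l) :
    chartι R l ≫ pMap φ v hv hX =
      Spec.map (CommRingCat.ofHom (gMap φ v hv i l h)) ≫ chartι k i := by
  have key : ∀ (t : MvPolynomial σ R) (ht : t ∈ homogeneousSubmodule σ R 1)
      (h : gEval φ v hv (X i) = t),
      Proj.awayι _ t ht one_pos ≫ pMap φ v hv hX =
      Spec.map (CommRingCat.ofHom (HomogeneousLocalization.map (P := .powers (X i))
        (Q := .powers t) (gEval φ v hv) (by rintro _ ⟨n, rfl⟩; exact ⟨n, by simp [← h]⟩)))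
       ≫ chartι k i := by
    rintro t ht rfl
    exact Proj.awayι_comp_map (gEval φ v hv) (gEval_irrelevant φ v hv hX) one_pos (X i) (X_mem i)
  exact key _ (X_mem l) (by simp [h])

/-- base change map -/
noncomputable def bMap (σ : Type) (φ : k →+* R) : PP σ R ⟶ PP σ k :=
  pMap φ X (fun i => isHomogeneous_X R i) (fun j => ⟨j, rfl⟩)

lemma isPullback_pMap_chart (φ : k →+* R) (v : τ → MvPolynomial σ R)
    (hv : ∀ i, (v i).IsHomogeneous 1) (hX : ∀ j, ∃ i, v i = X j) (i : τ) (l : σ) (h : v i = X l) :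
    IsPullback (chartι R l) (Spec.map (CommRingCat.ofHom (gMap φ v hv i l h)))
      (pMap φ v hv hX) (chartι k i) := by
  refine (IsOpenImmersion.isPullback _ _ _ _ (chartι_pMap φ v hv hX i l h) ?_).flip
  rw [opensRange_chartι, opensRange_chartι, pMap_preimage φ v hv hX i l h]

lemma isPullback_bMap (φ : k →+* R) :
    IsPullback (bMap σ φ) (strMap σ R) (strMap σ k) (Spec.map (CommRingCat.ofHom φ)) := by
  refine Scheme.isPullback_of_openCover _ _ _ _ (chartCover σ k).openCover fun l => ?_
  change σ at l
  have h1 : IsPullback (Spec.map (CommRingCat.ofHom (gMap φ X (fun i => isHomogeneous_X R i) l l rfl)))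
      (Spec.map (CommRingCat.ofHom (cChart (R := R) l)))
      (Spec.map (CommRingCat.ofHom (cChart (R := k) l))) (Spec.map (CommRingCat.ofHom φ)) :=
    isPullback_SpecMap_of_isPushout _ _ _ _ (chart_isPushout φ l).flip
  have h2 := isPullback_pMap_chart φ X (fun i => isHomogeneous_X R i) (fun j => ⟨j, rfl⟩) l l rfl
  change IsPullback (Limits.pullback.snd (bMap σ φ) (chartι k l))
    (Limits.pullback.fst (bMap σ φ) (chartι k l) ≫ strMap σ R) (chartι k l ≫ strMap σ k) _
  rw [chartι_strMap]
  refine h1.of_iso h2.isoPullback (Iso.refl _) (Iso.refl _) (Iso.refl _) ?_ ?_ ?_ ?_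
  · simp [bMap]
  · simp [bMap, chartι_strMap]
  · simp
  · simp

lemma closed_of_charts {X Y : Scheme.{0}} (g : X ⟶ Y) {ι : Type} (U V : ι → Scheme.{0})
    (c : ∀ i, U i ⟶ Y) [∀ i, IsOpenImmersion (c i)] (hc : ⨆ i, (c i).opensRange = ⊤)
    (a : ∀ i, V i ⟶ X) (b : ∀ i, V i ⟶ U i) (hP : ∀ i, IsPullback (a i) (b i) g (c i))
    (hb : ∀ i, IsClosedImmersion (b i)) : IsClosedImmersion g := by
  rw [IsZariskiLocalAtTarget.iff_of_iSup_eq_top (P := @IsClosedImmersion)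
    (fun l => (c l).opensRange) hc]
  intro i
  have := hb i
  refine (MorphismProperty.arrow_mk_iso_iff (P := @IsClosedImmersion)
    (morphismRestrictOpensRange g (c i))).mpr ?_
  rw [← (hP i).isoPullback_inv_snd]
  infer_instance

lemma pMap_isImmersion (φ : k →+* R) (v : τ → MvPolynomial σ R)
    (hv : ∀ i, (v i).IsHomogeneous 1) (hX : ∀ j, ∃ i, v i = X j)
    (hs : ∀ i l, (h : v i = X l) → Function.Surjective (gMap φ v hv i l h)) :
    IsImmersion (pMap φ v hv hX) := by
  have hX' := hX
  choose s hs' using hX'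
  let U : (PP τ k).Opens := ⨆ l, DD k (s l)
  have hU : Set.range (pMap φ v hv hX) ⊆ Set.range U.ι := by
    rw [Scheme.Opens.range_ι]
    rintro _ ⟨x, rfl⟩
    have : x ∈ (⨆ l : σ, DD R l) := by rw [iSup_DD]; trivial
    obtain ⟨l, hl⟩ := TopologicalSpace.Opens.mem_iSup.mp this
    rw [← pMap_preimage φ v hv hX (s l) l (hs' l)] at hl
    exact TopologicalSpace.Opens.mem_iSup.mpr ⟨l, hl⟩
  let g := IsOpenImmersion.lift U.ι (pMap φ v hv hX) hU
  have hg : g ≫ U.ι = pMap φ v hv hX := IsOpenImmersion.lift_fac _ _ _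
  suffices IsClosedImmersion g by rw [← hg]; infer_instance
  have hc : ∀ l, Set.range (chartι k (s l)) ⊆ Set.range U.ι := by
    intro l
    rw [Scheme.Opens.range_ι]
    have := opensRange_chartι (R := k) (s l)
    change ((chartι k (s l)).opensRange : Set (PP τ k)) ⊆ (U : Set (PP τ k))
    rw [this]
    exact le_iSup (fun l => DD k (s l)) l
  let c : ∀ l, Spec (CommRingCat.of (Chart k (s l))) ⟶ U.toScheme := fun l =>
    IsOpenImmersion.lift U.ι (chartι k (s l)) (hc l)
  have hc' : ∀ l, c l ≫ U.ι = chartι k (s l) := fun l => IsOpenImmersion.lift_fac _ _ _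
  have : ∀ l, IsOpenImmersion (c l) := fun l => by
    have : IsOpenImmersion (c l ≫ U.ι) := by rw [hc']; infer_instance
    exact IsOpenImmersion.of_comp (c l) U.ι
  have hP : ∀ l, IsPullback (chartι R l) (Spec.map (CommRingCat.ofHom (gMap φ v hv (s l) l (hs' l))))
      g (c l) := by
    intro l
    have := isPullback_pMap_chart φ v hv hX (s l) l (hs' l)
    rw [← hc', ← hg] at this
    have w : chartι R l ≫ g =
        Spec.map (CommRingCat.ofHom (gMap φ v hv (s l) l (hs' l))) ≫ c l := by
      rw [← cancel_mono U.ι]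
      simpa using this.w
    refine ⟨⟨w⟩, ⟨Limits.PullbackCone.IsLimit.mk w
      (fun t => this.lift t.fst t.snd (by simp [t.condition_assoc])) ?_ ?_ ?_⟩⟩
    · intro t; simp
    · intro t; simp
    · intro t m h1 h2
      apply this.hom_ext <;> simp [h1, h2]
  have hcl : ∀ l, IsClosedImmersion (Spec.map (CommRingCat.ofHom (gMap φ v hv (s l) l (hs' l)))) :=
    fun l => IsClosedImmersion.spec_of_surjective _ (hs _ _ (hs' l))
  refine closed_of_charts g _ _ c ?_ _ _ hP hcl
  rw [eq_top_iff]
  rintro x -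
  obtain ⟨l, hl⟩ := TopologicalSpace.Opens.mem_iSup.mp x.2
  refine TopologicalSpace.Opens.mem_iSup.mpr ⟨l, ?_⟩
  rw [← opensRange_chartι] at hl
  obtain ⟨y, hy⟩ := hl
  refine ⟨y, ?_⟩
  apply U.ι.isOpenEmbedding.injective
  rw [← Scheme.Hom.comp_apply, hc', hy]
  rfl

end geometry

section forward

variable {k R : Type} [CommRing k] [CommRing R] 

lemma segre_surj [Algebra k R] {σ : Type} {α : Type} (r : Option α → R) (h1 : r none = 1)
    (hr : Algebra.adjoin k (Set.range r) = ⊤) (v : σ × Option α → MvPolynomial σ R)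
    (hv' : v = fun i => C (r i.2) * X i.1)
    (hv : ∀ i, (v i).IsHomogeneous 1) (i : σ × Option α) (l : σ) (h : v i = X l) :
    Function.Surjective (gMap (algebraMap k R) v hv i l h) := by
  set g := gMap (algebraMap k R) v hv i l h
  have hx : ∀ m, xChart l m ∈ g.range := fun m =>
    ⟨xChart i (m, none), by rw [gMap_x, hv']; simp [h1, deh_X]⟩
  have hc : ∀ a : R, cChart l a ∈ g.range := by
    intro a
    have ha : a ∈ Algebra.adjoin k (Set.range r) := by rw [hr]; trivial
    induction ha using Algebra.adjoin_induction with
    | mem x hx =>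
      obtain ⟨o, rfl⟩ := hx
      exact ⟨xChart i (l, o), by rw [gMap_x, hv']; simp [deh_X, deh_C, xChart_self]⟩
    | algebraMap a => exact ⟨cChart i a, gMap_c ..⟩
    | add x y _ _ hx hy => rw [map_add]; exact add_mem hx hy
    | mul x y _ _ hx hy => rw [map_mul]; exact mul_mem hx hy
  intro x
  obtain ⟨p, rfl⟩ := deh_surjective l x
  change deh l p ∈ g.range
  induction p using MvPolynomial.induction_on with
  | C a => rw [deh_C]; exact hc a
  | add p q hp hq => rw [map_add]; exact add_mem hp hq
  | mul_X p n hp => rw [map_mul, deh_X]; exact mul_mem hp (hx n)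

/-- reindexing and Segre -/
lemma exists_immersion [Algebra k R] [Algebra.FiniteType k R] (n : ℕ) :
    ∃ (N : ℕ) (f : PP (Fin n) R ⟶ PP (Fin N) k), IsImmersion f := by
  obtain ⟨S, hS⟩ := (inferInstance : Algebra.FiniteType k R).out
  let r : Option S → R := fun o => o.elim 1 (fun x => x)
  let w : Fin n × Option S → MvPolynomial (Fin n) R := fun i => C (r i.2) * X i.1
  have hw : ∀ i, (w i).IsHomogeneous 1 := fun i => by
    simpa using (isHomogeneous_C (Fin n) (r i.2)).mul (isHomogeneous_X R i.1)
  have hr : Algebra.adjoin k (Set.range r) = ⊤ := by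
    rw [eq_top_iff, ← hS]
    exact Algebra.adjoin_mono fun x hx => ⟨some ⟨x, hx⟩, rfl⟩
  have him : IsImmersion (pMap (algebraMap k R) w hw (fun j => ⟨(j, none), by simp [w, r]⟩)) :=
    pMap_isImmersion _ _ _ _ fun i l h => segre_surj r rfl hr w rfl hw i l h
  let e := Fintype.equivFin (Fin n × Option S)
  refine ⟨_, pMap (algebraMap k R) w hw (fun j => ⟨(j, none), by simp [w, r]⟩) ≫
    pMap (RingHom.id k) (fun i => X (e.symm i)) (fun i => isHomogeneous_X k _) 
      (fun j => ⟨e j, by simp⟩), ?_⟩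
  have : IsImmersion (pMap (RingHom.id k) (fun i => X (e.symm i)) (fun i => isHomogeneous_X k _) 
      (fun j => ⟨e j, by simp⟩)) := by
    refine pMap_isImmersion _ _ _ _ fun i l h => ?_
    intro x
    obtain ⟨p, rfl⟩ := deh_surjective l x
    set g := gMap (RingHom.id k) (fun i => X (e.symm i)) (fun i => isHomogeneous_X k _) i l h
    change deh l p ∈ g.range
    induction p using MvPolynomial.induction_on with
    | C a => rw [deh_C]; exact ⟨cChart i a, gMap_c ..⟩
    | add p q hp hq => rw [map_add]; exact add_mem hp hq
    | mul_X p n hp =>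
      rw [map_mul, deh_X]
      exact mul_mem hp ⟨xChart i (e n), by rw [gMap_x]; simp [deh_X]⟩
  infer_instance

lemma toSpecZero_proper (n : ℕ) : IsProper (Proj.toSpecZero (homogeneousSubmodule (Fin n) R)) := by
  classical
  have : Algebra.FiniteType (homogeneousSubmodule (Fin n) R 0) (MvPolynomial (Fin n) R) := by
    refine ⟨⟨Finset.univ.image X, ?_⟩⟩
    rw [eq_top_iff]
    rintro p -
    induction p using MvPolynomial.induction_on with
    | C a => 
      exact Subalgebra.algebraMap_mem _ (cZero (Fin n) R a)
    | add p q hp hq => exact add_mem hp hq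
    | mul_X p n hp =>
      exact mul_mem hp (Algebra.subset_adjoin (by simp))
  infer_instance

end forward

section backward

variable {k A : Type} [CommRing k] [CommRing A] {σ : Type}

lemma chart_lift {V W : Scheme.{0}} (β : k →+* A) (f : W ⟶ PP σ A) (j : W ⟶ PP σ k)
    (hf : f ≫ bMap σ β = j) (l : σ) (a : V ⟶ W) (b : V ⟶ Spec (CommRingCat.of (Chart k l)))
    (h : IsPullback a b j (chartι k l)) :
    ∃ b' : V ⟶ Spec (CommRingCat.of (Chart A l)), IsPullback a b' f (chartι A l) := by
  have h2 := isPullback_pMap_chart β X (fun i => isHomogeneous_X A i) (fun j => ⟨j, rfl⟩) l l rfl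
  change IsPullback _ _ (bMap σ β) _ at h2
  subst hf
  have w : (a ≫ f) ≫ bMap σ β = b ≫ chartι k l := by simpa using h.w
  refine ⟨h2.lift (a ≫ f) b w, ?_⟩
  refine IsPullback.of_bot ?_ ?_ h2
  · rw [h2.lift_snd]
    exact h
  · rw [h2.lift_fst]

lemma chart_comp {B : CommRingCat.{0}} {W : Scheme.{0}} (β : k →+* A) (f : W ⟶ PP σ A)
    (j : W ⟶ PP σ k) (hf : f ≫ bMap σ β = j) (l : σ) (a : Spec B ⟶ W)
    (b : CommRingCat.of (Chart k l) ⟶ B) (c : CommRingCat.of (Chart A l) ⟶ B)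
    (hb : a ≫ j = Spec.map b ≫ chartι k l) (hc : a ≫ f = Spec.map c ≫ chartι A l) :
    b = CommRingCat.ofHom (gMap β X (fun i => isHomogeneous_X A i) l l rfl) ≫ c := by
  apply Spec.map_injective
  rw [Spec.map_comp, ← cancel_mono (chartι k l), Category.assoc,
    ← chartι_pMap β X (fun i => isHomogeneous_X A i) (fun j => ⟨j, rfl⟩) l l rfl,
    ← hb, ← hf, reassoc_of% hc]
  rfl

lemma gMap_deh (β : k →+* A) (l : σ) (q : MvPolynomial σ k) :
    gMap β X (fun i => isHomogeneous_X A i) l l rfl (deh l q) = deh l (MvPolynomial.map β q) := by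
  induction q using MvPolynomial.induction_on with
  | C a => simp [deh_C, gMap_c]
  | add p q hp hq => simp [hp, hq]
  | mul_X p n hp => simp [hp, deh_X, gMap_x]

lemma bMap_comp {G : Type} [CommRing G] (β : k →+* A) (γ : A →+* G) :
    bMap σ γ ≫ bMap σ β = bMap σ (γ.comp β) := by
  refine (chartCover σ G).openCover.hom_ext _ _ fun l => ?_
  change σ at l
  change chartι G l ≫ _ = chartι G l ≫ _
  rw [bMap, bMap, bMap, ← Category.assoc, 
    chartι_pMap γ X (fun i => isHomogeneous_X G i) (fun j => ⟨j, rfl⟩) l l rfl, Category.assoc,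
    chartι_pMap β X (fun i => isHomogeneous_X A i) (fun j => ⟨j, rfl⟩) l l rfl,
    chartι_pMap (γ.comp β) X (fun i => isHomogeneous_X G i) (fun j => ⟨j, rfl⟩) l l rfl,
    ← Category.assoc, ← Spec.map_comp, ← CommRingCat.ofHom_comp]
  congr 3
  apply chart_hom_ext
  · intro a; simp [gMap_c]
  · intro m; simp [gMap_x, deh_X]

lemma toSpecΓ_proper {X Z : Scheme.{0}} [IsAffine Z] (p : X ⟶ Z) [IsProper p] :
    IsProper X.toSpecΓ := by
  have : IsProper (X.toSpecΓ ≫ Spec.map p.appTop) := by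
    rw [← Scheme.toSpecΓ_naturality]
    infer_instance
  exact IsProper.of_comp _ (Spec.map p.appTop)

lemma exists_toSpecΓ {X : Scheme.{0}} (R : CommRingCat.{0}) (f : X ⟶ Spec R) :
    ∃ α : R ⟶ Γ(X, ⊤), f = X.toSpecΓ ≫ Spec.map α := by
  refine ⟨(Scheme.ΓSpecIso R).inv ≫ f.appTop, ?_⟩
  rw [Spec.map_comp, ← Scheme.toSpecΓ_naturality_assoc]
  simp

lemma closed_of_proper_of_immersion {X Y : Scheme.{0}} (f : X ⟶ Y) [IsImmersion f] [IsProper f] :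
    IsClosedImmersion f :=
  .of_isPreimmersion f f.isClosedMap.isClosed_range

lemma surj_of_closed {R S : CommRingCat.{0}} (f : R ⟶ S) (h : IsClosedImmersion (Spec.map f)) :
    Function.Surjective f.hom := by
  have h1 := (IsClosedImmersion.isAffine_surjective_of_isAffine (Spec.map f)).2
  have h2 := Scheme.ΓSpecIso_naturality f
  have h3 : f = (Scheme.ΓSpecIso R).inv ≫ (Spec.map f).appTop ≫ (Scheme.ΓSpecIso S).hom := by
    rw [Iso.eq_inv_comp, h2]
  rw [h3]
  simp only [CommRingCat.hom_comp, RingHom.coe_comp]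
  exact ((ConcreteCategory.bijective_of_isIso (Scheme.ΓSpecIso S).hom).2.comp h1).comp
    (ConcreteCategory.bijective_of_isIso (Scheme.ΓSpecIso R).inv).2

lemma main_backward [Finite σ] {W : Scheme.{0}} (j : W ⟶ PP σ k) [IsImmersion j]
    (hp : IsProper W.toSpecΓ) :
    ∃ (α : k →+* Γ(W, ⊤)) (T : Set Γ(W, ⊤)), T.Finite ∧
      ∀ (A : Type) [CommRing A] (β : k →+* A) (γ : A →+* Γ(W, ⊤)), γ.comp β = α →
        T ⊆ Set.range γ → ∃ f : W ⟶ PP σ A, IsClosedImmersion f := by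
  obtain ⟨α, hα⟩ := exists_toSpecΓ _ (j ≫ strMap σ k)
  obtain ⟨α, rfl⟩ : ∃ α' : k →+* Γ(W, ⊤), α = CommRingCat.ofHom α' := ⟨α.hom, rfl⟩
  let fG : W ⟶ PP σ Γ(W, ⊤) := (isPullback_bMap α).lift j W.toSpecΓ hα
  have hG1 : fG ≫ bMap σ α = j := (isPullback_bMap α).lift_fst _ _ _
  have hG2 : fG ≫ strMap σ _ = W.toSpecΓ := (isPullback_bMap α).lift_snd _ _ _
  have hGi : IsImmersion fG := by
    have : IsImmersion (fG ≫ bMap σ α) := by rw [hG1]; infer_instance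
    exact IsImmersion.of_comp _ (bMap σ α)
  have hGp : IsProper fG := by
    have : IsProper (fG ≫ strMap σ _) := by rw [hG2]; infer_instance
    exact IsProper.of_comp _ (strMap σ _)
  have hGc : IsClosedImmersion fG := closed_of_proper_of_immersion fG
  have hchart : ∀ l : σ, ∃ (B : CommRingCat.{0}) (a : Spec B ⟶ W)
      (b : CommRingCat.of (Chart k l) ⟶ B) (c : CommRingCat.of (Chart Γ(W, ⊤) l) ⟶ B),
      IsPullback a (Spec.map b) j (chartι k l) ∧ a ≫ fG = Spec.map c ≫ chartι _ l ∧
      Function.Surjective c.hom ∧ b.hom.FiniteType := by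
    intro l
    have h0 := IsPullback.of_hasPullback j (chartι k l)
    obtain ⟨b', hb'⟩ := chart_lift α fG j hG1 l _ _ h0
    have hb'c : IsClosedImmersion b' := MorphismProperty.of_isPullback hb' hGc
    have : IsAffine (Limits.pullback j (chartι k l)) :=
      (IsClosedImmersion.isAffine_surjective_of_isAffine b').1
    let e := (Limits.pullback j (chartι k l)).isoSpec
    obtain ⟨b, hb⟩ := Spec.map_surjective (e.inv ≫ Limits.pullback.snd j (chartι k l))
    obtain ⟨c, hc⟩ := Spec.map_surjective (e.inv ≫ b')
    have hpb : IsPullback (e.inv ≫ Limits.pullback.fst j (chartι k l)) (Spec.map b) j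
        (chartι k l) := by
      rw [hb]
      refine h0.of_iso e (Iso.refl _) (Iso.refl _) (Iso.refl _) ?_ ?_ ?_ ?_ <;> simp
    refine ⟨_, e.inv ≫ Limits.pullback.fst _ _, b, c, hpb, ?_, ?_, ?_⟩
    · rw [hc, Category.assoc, Category.assoc, hb'.w]
    · apply surj_of_closed
      rw [hc]
      infer_instance
    · have h1 : IsImmersion (Spec.map b) := MorphismProperty.of_isPullback hpb inferInstance
      have h2 : LocallyOfFiniteType (Spec.map b) := inferInstance
      exact (HasRingHomProperty.Spec_iff (P := @LocallyOfFiniteType)).mp h2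
  choose B a b c hpb hac hcs hbf using hchart
  have hS : ∀ l, ∃ S : Finset (B l), @Algebra.adjoin _ _ _ _ (b l).hom.toAlgebra (S : Set (B l)) = ⊤ :=
    fun l => (hbf l).out
  choose S hS using hS
  have hq : ∀ l (s : B l), ∃ q, (c l).hom (deh l q) = s := fun l s => by
    obtain ⟨y, rfl⟩ := hcs l s
    obtain ⟨q, rfl⟩ := deh_surjective l y
    exact ⟨q, rfl⟩
  choose q hq using hq
  refine ⟨α, ⋃ l, ⋃ s ∈ S l, ((q l s).coeffs : Set Γ(W, ⊤)), ?_, ?_⟩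
  · exact Set.finite_iUnion fun l => (S l).finite_toSet.biUnion fun s _ => Finset.finite_toSet _
  intro A _ β γ hγ hT
  have hf : (fG ≫ bMap σ γ) ≫ bMap σ β = j := by rw [Category.assoc, bMap_comp, hγ, hG1]
  refine ⟨fG ≫ bMap σ γ, ?_⟩
  have hch : ∀ l, ∃ c' : CommRingCat.of (Chart A l) ⟶ B l,
      IsPullback (a l) (Spec.map c') (fG ≫ bMap σ γ) (chartι A l) := by
    intro l
    obtain ⟨b', hb'⟩ := chart_lift β _ j hf l _ _ (hpb l)
    obtain ⟨c', rfl⟩ := Spec.map_surjective b'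
    exact ⟨c', hb'⟩
  choose c' hc' using hch
  refine closed_of_charts (fG ≫ bMap σ γ) _ _ (fun l => chartι A l) ?_ a _ hc' fun l => ?_
  · simp_rw [opensRange_chartι]
    exact iSup_DD
  refine IsClosedImmersion.spec_of_surjective _ ?_
  have h1 := chart_comp β _ j hf l (a l) (b l) (c' l) (hpb l).w (hc' l).w
  have h2 := chart_comp γ fG _ rfl l (a l) (c' l) (c l) (hc' l).w (hac l)
  intro y
  change y ∈ (c' l).hom.range
  letI := (b l).hom.toAlgebra
  have hy : y ∈ Algebra.adjoin (Chart k l) (S l : Set (B l)) := by rw [hS l]; trivial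
  induction hy using Algebra.adjoin_induction with
  | mem s hs =>
    obtain ⟨q', hq'⟩ := mem_range_map_iff_coeffs_subset.mpr (show ((q l s).coeffs : Set Γ(W, ⊤)) ⊆ _ from
      fun x hx => hT (Set.mem_iUnion.mpr ⟨l, Set.mem_biUnion hs hx⟩))
    refine ⟨deh l q', ?_⟩
    rw [h2, ← hq l s, ← hq', ← gMap_deh]
    rfl
  | algebraMap x =>
    refine ⟨gMap β X (fun i => isHomogeneous_X A i) l l rfl x, ?_⟩
    change _ = (b l).hom x
    rw [h1]
    rfl
  | add x y _ _ hx hy => exact add_mem hx hy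
  | mul x y _ _ hx hy => exact mul_mem hx hy

end backward

end SemiProj
/-- A variety `X` over an algebraically closed field `k` of characteristic zero
is semiprojective (projective over an affine variety) if and only if it is quasiprojective
and semicomplete. -/
theorem semiprojective_iff_quasiprojective_and_semicomplete
    (k : Type) [Field k] [IsAlgClosed k] [CharZero k]
    (X : AlgebraicGeometry.Scheme) [AlgebraicGeometry.IsIntegral X]
    (sX : X ⟶ AlgebraicGeometry.Spec (CommRingCat.of k))
    [AlgebraicGeometry.IsSeparated sX] [AlgebraicGeometry.LocallyOfFiniteType sX]
    [AlgebraicGeometry.QuasiCompact sX] :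
    IsSemiprojective k X ↔ IsQuasiprojective k X ∧ IsSemicomplete X := by
  constructor
  · rintro ⟨R, _, _, _, _, n, i, hi⟩
    constructor
    · obtain ⟨N, f, hf⟩ := SemiProj.exists_immersion (k := k) (R := R) n
      let f' : ProjectiveSpaceOver R n ⟶ ProjectiveSpaceOver k N := f
      have hf' : IsImmersion f' := hf
      exact ⟨N, i ≫ f', inferInstance⟩
    · have := SemiProj.toSpecZero_proper (R := R) n
      let p : ProjectiveSpaceOver R n ⟶ _ := 
        Proj.toSpecZero (MvPolynomial.homogeneousSubmodule (Fin n) R)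
      have hp : IsProper p := this
      exact ⟨_, i ≫ p, by infer_instance, by infer_instance⟩
  · rintro ⟨⟨n, j, hj⟩, Z, p, hZ, hp⟩
    have hj' : IsImmersion (X := X) (Y := SemiProj.PP (Fin n) k) j := hj
    obtain ⟨α, T, hT, H⟩ := SemiProj.main_backward (σ := Fin n) (k := k) j (SemiProj.toSpecΓ_proper p)
    letI := α.toAlgebra
    let A := Algebra.adjoin k T
    obtain ⟨f, hf⟩ := H A (algebraMap k A) A.val.toRingHom rfl (fun x hx =>
      ⟨⟨x, Algebra.subset_adjoin hx⟩, rfl⟩)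
    have hA : Algebra.FiniteType k A :=
      A.fg_iff_finiteType.mp (Subalgebra.fg_def.mpr ⟨T, hT, rfl⟩)
    exact ⟨A, inferInstance, inferInstance, inferInstance, hA, n, f, hf⟩
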